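/- For every integer n ≥ 0, the group G_{p,n}(A,I) = {α ∈ G_p(A,I) : (α_i)^(p^(n−i+1)) = 0 for all 1 ≤ i ≤ n, and α_i = 0 for all i ≥ n+1} is nilpotent of class at most n+1: its lower central series satisfies Γ_{n+1}(G_{p,n}(A,I)) = {δ}. Moreover, in the special case I = {0} (so that every element has α_0 = 1), the group G_{p,n}(A,{0}) is nilpotent of class at most n: Γ_n(G_{p,n}(A,{0})) = {δ}. Here Γ_0(G) = G and Γ_{k+1}(G) = [Γ_k(G), G]. -/

import Mathlib

/-- The product of two coefficient sequences, encoding substitution of the power series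
`∑_{j≥0} α_j X^(p^j)` into `∑_{i≥0} β_i X^(p^i)`:
`(α·β)_i = ∑_{j=0}^{i} (α_{i−j})^(p^j) · β_j`. -/
def seqMul {A : Type*} [CommRing A] (p : ℕ) (α β : ℕ → A) : ℕ → A :=
  fun i => ∑ j ∈ Finset.range (i + 1), α (i - j) ^ p ^ j * β j

/-- The identity sequence `δ`, with `δ_0 = 1` and `δ_i = 0` for `i ≥ 1`. -/
def seqOne {A : Type*} [CommRing A] : ℕ → A :=
  fun i => if i = 0 then 1 else 0

/-- `I` is a square-zero ideal: `x·y = 0` for all `x, y ∈ I`. -/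
def IsSqZero {A : Type*} [CommRing A] (I : Ideal A) : Prop :=
  ∀ x ∈ I, ∀ y ∈ I, x * y = 0

/-- The Steenrod group `G_p(A,I)`: sequences `α : ℕ → A` with `α 0 - 1 ∈ I`. -/
def steenrodSet {A : Type*} [CommRing A] (I : Ideal A) : Set (ℕ → A) :=
  {α | α 0 - 1 ∈ I}

/-- The filtration subgroup `G_p^(k)(A,I)`: sequences with `α_0 = 1` and `α_i = 0`
for `1 ≤ i ≤ k`. -/
def steenrodFil {A : Type*} [CommRing A] (k : ℕ) : Set (ℕ → A) :=
  {α | α 0 = 1 ∧ ∀ i : ℕ, 1 ≤ i → i ≤ k → α i = 0}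

/-- The filtration subgroup `G_p^(k+0.5)(A,I)`: elements of `G_p^(k)(A,I)` with
`α_{k+1} ∈ I`. -/
def steenrodFilHalf {A : Type*} [CommRing A] (I : Ideal A) (k : ℕ) : Set (ℕ → A) :=
  {α | α ∈ steenrodFil k ∧ α (k + 1) ∈ I}

/-- `S` is a subgroup for the product `seqMul p`: it contains the identity `δ`, is
closed under the product, and is closed under two-sided inverses. -/
def IsSeqSubgroup {A : Type*} [CommRing A] (p : ℕ) (S : Set (ℕ → A)) : Prop :=
  seqOne ∈ S ∧
  (∀ a ∈ S, ∀ b ∈ S, seqMul p a b ∈ S) ∧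
  (∀ a ∈ S, ∀ a' : ℕ → A, seqMul p a a' = seqOne → seqMul p a' a = seqOne → a' ∈ S)

/-- The set of commutators `(a⁻¹·b⁻¹)·(a·b)` with `a ∈ H` and `b ∈ K` (inverses being
two-sided inverses for the product `seqMul p`). -/
def commSet {A : Type*} [CommRing A] (p : ℕ) (H K : Set (ℕ → A)) : Set (ℕ → A) :=
  {c | ∃ a ∈ H, ∃ b ∈ K, ∃ a' b' : ℕ → A,
    seqMul p a a' = seqOne ∧ seqMul p a' a = seqOne ∧
    seqMul p b b' = seqOne ∧ seqMul p b' b = seqOne ∧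
    c = seqMul p (seqMul p a' b') (seqMul p a b)}

/-- The subgroup (for the product `seqMul p`) generated by a set `S` of sequences:
the smallest set containing `S` and `δ`, closed under the product and under two-sided
inverses. -/
inductive SeqSubgroupClosure {A : Type*} [CommRing A] (p : ℕ) (S : Set (ℕ → A)) :
    (ℕ → A) → Prop
  | of {x : ℕ → A} : x ∈ S → SeqSubgroupClosure p S x
  | one : SeqSubgroupClosure p S seqOne
  | mul {x y : ℕ → A} : SeqSubgroupClosure p S x → SeqSubgroupClosure p S y →
      SeqSubgroupClosure p S (seqMul p x y)
  | inv {x y : ℕ → A} : SeqSubgroupClosure p S x → seqMul p x y = seqOne →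
      seqMul p y x = seqOne → SeqSubgroupClosure p S y

/-- The lower central series of a subgroup `S` (with respect to the product
`seqMul p`): `Γ_0(S) = S` and `Γ_{k+1}(S) = [Γ_k(S), S]`, the subgroup generated by
commutators. -/
def seqLowerCentral {A : Type*} [CommRing A] (p : ℕ) (S : Set (ℕ → A)) :
    ℕ → Set (ℕ → A)
  | 0 => S
  | k + 1 => {x | SeqSubgroupClosure p (commSet p (seqLowerCentral p S k) S) x}

/-- The finite subgroup `G_{p,n}(A,I)` of the Steenrod group: sequences
`α ∈ G_p(A,I)` with `(α_i)^(p^(n−i+1)) = 0` for `1 ≤ i ≤ n` and `α_i = 0` for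
`i ≥ n+1`. -/
def steenrodFinite {A : Type*} [CommRing A] (p n : ℕ) (I : Ideal A) : Set (ℕ → A) :=
  {α | α 0 - 1 ∈ I ∧ (∀ i : ℕ, 1 ≤ i → i ≤ n → α i ^ p ^ (n - i + 1) = 0) ∧
    ∀ i : ℕ, n + 1 ≤ i → α i = 0}

section SeqMul

variable {A : Type*} [CommRing A] {p : ℕ}

theorem map_seqMul {B : Type*} [CommRing B] (f : A →+* B) (a b : ℕ → A) (i : ℕ) :
    f (seqMul p a b i) = seqMul p (fun j => f (a j)) (fun j => f (b j)) i := by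
  simp [seqMul]

theorem map_seqOne {B : Type*} [CommRing B] (f : A →+* B) (i : ℕ) :
    f (seqOne i) = seqOne i := by
  simp only [seqOne]; split_ifs <;> simp

theorem seqMul_congr {a a' b b' : ℕ → A} {i : ℕ} (ha : ∀ j ≤ i, a j = a' j)
    (hb : ∀ j ≤ i, b j = b' j) : seqMul p a b i = seqMul p a' b' i := by
  refine Finset.sum_congr rfl fun j hj => ?_
  rw [ha _ (Nat.sub_le i j), hb _ (Nat.lt_succ_iff.mp (Finset.mem_range.mp hj))]

theorem seqMul_zero (a b : ℕ → A) : seqMul p a b 0 = a 0 * b 0 := by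
  simp [seqMul]

theorem one_seqMul (hp : p ≠ 0) (b : ℕ → A) : seqMul p seqOne b = b := by
  funext i
  rw [seqMul, Finset.sum_range_succ, Finset.sum_eq_zero, zero_add]
  · simp [seqOne]
  · intro j hj
    have : i - j ≠ 0 := by have := Finset.mem_range.mp hj; omega
    simp [seqOne, this, hp]

theorem seqMul_one (a : ℕ → A) : seqMul p a seqOne = a := by
  funext i
  rw [seqMul, Finset.sum_range_succ', Finset.sum_eq_zero, zero_add]
  · simp [seqOne]
  · simp [seqOne]

theorem seqMul_assoc [ExpChar A p] (a b c : ℕ → A) :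
    seqMul p (seqMul p a b) c = seqMul p a (seqMul p b c) := by
  funext i
  simp only [seqMul, sum_pow_char_pow, Finset.sum_mul, Finset.mul_sum, mul_pow]
  rw [Finset.sum_sigma', Finset.sum_sigma']
  refine Finset.sum_bij' (fun x _ => ⟨x.1 + x.2, x.1⟩) (fun x _ => ⟨x.2, x.1 - x.2⟩)
    ?_ ?_ ?_ ?_ ?_
  · rintro ⟨j, l⟩ h
    simp only [Finset.mem_sigma, Finset.mem_range] at h ⊢
    omega
  · rintro ⟨j, l⟩ h
    simp only [Finset.mem_sigma, Finset.mem_range] at h ⊢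
    omega
  · rintro ⟨j, l⟩ h
    simp
  · rintro ⟨j, l⟩ h
    simp only [Finset.mem_sigma, Finset.mem_range] at h
    simp only [Sigma.mk.injEq, heq_eq_eq, and_true]
    omega
  · rintro ⟨j, l⟩ h
    simp only [← pow_mul, ← pow_add, Nat.add_sub_cancel_left, Nat.sub_sub, mul_assoc,
      Nat.add_comm l j]

theorem seqMul_eq_of_eq_one_lt (hp : p ≠ 0) {a b : ℕ → A} {k : ℕ} (hk : k ≠ 0)
    (ha : ∀ i < k, a i = seqOne i) : seqMul p a b k = a k * b 0 + b k := by
  obtain ⟨m, rfl⟩ := Nat.exists_eq_succ_of_ne_zero hk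
  rw [seqMul, Finset.sum_range_succ, Finset.sum_range_succ', Finset.sum_eq_zero]
  · simp [ha 0 (Nat.succ_pos m), seqOne]
  · intro j hj
    have hj := Finset.mem_range.mp hj
    rw [ha _ (by omega), seqOne, if_neg (by omega), zero_pow (pow_ne_zero _ hp), zero_mul]

theorem seqMul_eq_of_lt_eq_one {a b : ℕ → A} {k : ℕ} (hk : k ≠ 0)
    (ha : ∀ i < k, a i = seqOne i) : seqMul p b a k = b k + b 0 ^ p ^ k * a k := by
  obtain ⟨m, rfl⟩ := Nat.exists_eq_succ_of_ne_zero hk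
  rw [seqMul, Finset.sum_range_succ, Finset.sum_range_succ', Finset.sum_eq_zero]
  · simp [ha 0 (Nat.succ_pos m), seqOne]
  · intro j hj
    have hj := Finset.mem_range.mp hj
    rw [ha _ (by omega), seqOne, if_neg (by omega), mul_zero]

theorem pow_prime_pow_eq_one_of_isSqZero [ExpChar A p] (hp : 2 ≤ p) {I : Ideal A}
    (hI : IsSqZero I) {x : A} (hx : x - 1 ∈ I) {k : ℕ} (hk : k ≠ 0) : x ^ p ^ k = 1 := by
  have h2 : (x - 1) ^ 2 = 0 := by rw [sq]; exact hI _ hx _ hx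
  have hle : 2 ≤ p ^ k := hp.trans (Nat.le_self_pow hk p)
  rw [← sub_eq_zero]
  simpa [sub_pow_expChar_pow] using pow_eq_zero_of_le hle h2

/-! ### Generated subgroups -/

theorem SeqSubgroupClosure.mem {S T : Set (ℕ → A)} (hT : IsSeqSubgroup p T) (h : S ⊆ T)
    {x : ℕ → A} (hx : SeqSubgroupClosure p S x) : x ∈ T := by
  induction hx with
  | of hx => exact h hx
  | one => exact hT.1
  | mul _ _ ihx ihy => exact hT.2.1 _ ihx _ ihy
  | inv _ h₁ h₂ ih => exact hT.2.2 _ ih _ h₁ h₂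

theorem commSet_subset {S H K : Set (ℕ → A)} (hS : IsSeqSubgroup p S) (hH : H ⊆ S)
    (hK : K ⊆ S) : commSet p H K ⊆ S := by
  rintro c ⟨a, ha, b, hb, a', b', h₁, h₂, h₃, h₄, rfl⟩
  exact hS.2.1 _ (hS.2.1 _ (hS.2.2 _ (hH ha) _ h₁ h₂) _ (hS.2.2 _ (hK hb) _ h₃ h₄)) _
    (hS.2.1 _ (hH ha) _ (hK hb))

theorem seqLowerCentral_subset {S : Set (ℕ → A)} (hS : IsSeqSubgroup p S) (k : ℕ) :
    seqLowerCentral p S k ⊆ S := by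
  induction k with
  | zero => exact subset_rfl
  | succ k ih => exact fun x hx => SeqSubgroupClosure.mem hS (commSet_subset hS ih subset_rfl) hx

theorem one_mem_seqLowerCentral {S : Set (ℕ → A)} (hS : seqOne ∈ S) (k : ℕ) :
    seqOne ∈ seqLowerCentral p S k := by
  cases k with
  | zero => exact hS
  | succ k => exact SeqSubgroupClosure.one

/-! ### The filtration -/

/-- The sequences that agree with `δ` below index `m`, and modulo `I` at index `m`. -/
def seqFiltration (I : Ideal A) (m : ℕ) : Set (ℕ → A) :=
  {a | (∀ i < m, a i = seqOne i) ∧ a m - seqOne m ∈ I}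

theorem mk_eq_seqOne_of_mem_seqFiltration {I : Ideal A} {m : ℕ} {a : ℕ → A}
    (ha : a ∈ seqFiltration I m) : ∀ i ≤ m, Ideal.Quotient.mk I (a i) = seqOne i := by
  intro i hi
  rw [← map_seqOne (Ideal.Quotient.mk I)]
  rcases hi.lt_or_eq with h | rfl
  · rw [ha.1 i h]
  · exact Ideal.Quotient.eq.mpr ha.2

theorem mem_seqFiltration_of_mk_eq {I : Ideal A} {m : ℕ} {a : ℕ → A}
    (h₁ : ∀ i < m, a i = seqOne i) (h₂ : Ideal.Quotient.mk I (a m) = seqOne m) :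
    a ∈ seqFiltration I m :=
  ⟨h₁, Ideal.Quotient.eq.mp (by rw [h₂, map_seqOne])⟩

theorem seqMul_eq_one_of_eq_one (hp : p ≠ 0) {a b : ℕ → A} {i : ℕ}
    (ha : ∀ j ≤ i, a j = seqOne j) (hb : ∀ j ≤ i, b j = seqOne j) :
    seqMul p a b i = seqOne i := by
  rw [seqMul_congr ha hb, one_seqMul hp]

theorem eq_one_of_seqMul_eq_one (hp : p ≠ 0) {a b : ℕ → A} {i : ℕ}
    (ha : ∀ j ≤ i, a j = seqOne j) (h : seqMul p a b i = seqOne i) : b i = seqOne i := by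
  rw [← h, seqMul_congr ha fun _ _ => rfl, one_seqMul hp]

theorem isSeqSubgroup_seqFiltration (hp : p ≠ 0) (I : Ideal A) (m : ℕ) :
    IsSeqSubgroup p (seqFiltration I m) := by
  refine ⟨⟨fun _ _ => rfl, by simp⟩, fun a ha b hb => ?_, fun a ha b hab _ => ?_⟩
  · refine mem_seqFiltration_of_mk_eq (fun i hi => seqMul_eq_one_of_eq_one hp
      (fun j hj => ha.1 j (hj.trans_lt hi)) fun j hj => hb.1 j (hj.trans_lt hi)) ?_
    rw [map_seqMul]
    exact seqMul_eq_one_of_eq_one hp (mk_eq_seqOne_of_mem_seqFiltration ha)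
      (mk_eq_seqOne_of_mem_seqFiltration hb)
  · refine mem_seqFiltration_of_mk_eq (fun i hi => eq_one_of_seqMul_eq_one hp
      (fun j hj => ha.1 j (hj.trans_lt hi)) (congrFun hab i)) ?_
    refine eq_one_of_seqMul_eq_one (b := fun j => Ideal.Quotient.mk I (b j)) hp
      (mk_eq_seqOne_of_mem_seqFiltration ha) ?_
    rw [← map_seqMul, hab, map_seqOne]

theorem seqMul_comm_of_mem_seqFiltration [ExpChar A p] (hp : 2 ≤ p) {I : Ideal A}
    (hI : IsSqZero I) {m : ℕ} {a b : ℕ → A} (ha : a ∈ seqFiltration I m) (hb : b 0 - 1 ∈ I)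
    {i : ℕ} (hi : i ≤ m) : seqMul p a b i = seqMul p b a i := by
  have hp0 : p ≠ 0 := by omega
  rcases hi.lt_or_eq with h | rfl
  · have ha' : ∀ j ≤ i, a j = seqOne j := fun j hj => ha.1 j (hj.trans_lt h)
    rw [seqMul_congr ha' fun _ _ => rfl, seqMul_congr (fun _ _ => rfl) ha', one_seqMul hp0,
      seqMul_one]
  · rcases eq_or_ne i 0 with rfl | hi0
    · rw [seqMul_zero, seqMul_zero, mul_comm]
    · rw [seqMul_eq_of_eq_one_lt hp0 hi0 ha.1, seqMul_eq_of_lt_eq_one hi0 ha.1,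
        pow_prime_pow_eq_one_of_isSqZero hp hI hb hi0]
      have := hI _ ha.2 _ hb
      rw [seqOne, if_neg hi0] at this
      linear_combination this

theorem mk_seqMul_comm_of_mem_seqFiltration (hp : p ≠ 0) {I : Ideal A} {m : ℕ} {a b : ℕ → A}
    (ha : a ∈ seqFiltration I m) (hb : b 0 - 1 ∈ I) :
    Ideal.Quotient.mk I (seqMul p a b (m + 1)) = Ideal.Quotient.mk I (seqMul p b a (m + 1)) := by
  have ha' := fun i (hi : i < m + 1) =>
    mk_eq_seqOne_of_mem_seqFiltration ha i (Nat.lt_succ_iff.mp hi)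
  have hb' : Ideal.Quotient.mk I (b 0) = 1 := by
    rw [← map_one (Ideal.Quotient.mk I)]
    exact Ideal.Quotient.eq.mpr hb
  rw [map_seqMul, map_seqMul, seqMul_eq_of_eq_one_lt hp m.succ_ne_zero ha',
    seqMul_eq_of_lt_eq_one m.succ_ne_zero ha', hb', one_pow, mul_one, one_mul, add_comm]

theorem commSet_seqFiltration_subset [ExpChar A p] (hp : 2 ≤ p) {I : Ideal A}
    (hI : IsSqZero I) {m : ℕ} {H K : Set (ℕ → A)} (hH : H ⊆ seqFiltration I m)
    (hK : K ⊆ steenrodSet I) : commSet p H K ⊆ seqFiltration I (m + 1) := by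
  rintro c ⟨a, ha, b, hb, a', b', -, h₂, -, h₄, rfl⟩
  have hp0 : p ≠ 0 := by omega
  have hinv : seqMul p (seqMul p a' b') (seqMul p b a) = seqOne := by
    rw [seqMul_assoc, ← seqMul_assoc b', h₄, one_seqMul hp0, h₂]
  have hcomm : ∀ j ≤ m, seqMul p a b j = seqMul p b a j := fun j hj =>
    seqMul_comm_of_mem_seqFiltration hp hI (hH ha) (hK hb) hj
  refine mem_seqFiltration_of_mk_eq (fun i hi => ?_) ?_
  · rw [seqMul_congr (fun _ _ => rfl) fun j hj => hcomm j (by omega), hinv]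
  · rw [← map_seqOne (Ideal.Quotient.mk I), ← hinv, map_seqMul, map_seqMul]
    refine seqMul_congr (fun _ _ => rfl) fun j hj => ?_
    rcases hj.lt_or_eq with h | rfl
    · rw [hcomm j (Nat.lt_succ_iff.mp h)]
    · exact mk_seqMul_comm_of_mem_seqFiltration hp0 (hH ha) (hK hb)

theorem seqLowerCentral_subset_seqFiltration [ExpChar A p] (hp : 2 ≤ p) {I : Ideal A}
    (hI : IsSqZero I) {S : Set (ℕ → A)} (hS : S ⊆ steenrodSet I) (m : ℕ) :
    seqLowerCentral p S m ⊆ seqFiltration I m := by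
  induction m with
  | zero => exact fun a ha => ⟨by simp, by simpa [seqOne, steenrodSet] using hS ha⟩
  | succ m ih =>
    exact fun x hx => SeqSubgroupClosure.mem (isSeqSubgroup_seqFiltration (by omega) I _)
      (commSet_seqFiltration_subset hp hI ih hS) hx

/-! ### The finite subgroups -/

theorem mem_steenrodFinite_iff {n : ℕ} {I : Ideal A} {a : ℕ → A} :
    a ∈ steenrodFinite p n I ↔
      a 0 - 1 ∈ I ∧ ∀ i : ℕ, 1 ≤ i → a i ^ p ^ (n + 1 - i) = 0 := by
  refine and_congr_right fun _ => ⟨fun ⟨h₁, h₂⟩ i hi => ?_, fun h => ⟨fun i hi hn => ?_,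
    fun i hi => ?_⟩⟩
  · rcases le_or_gt i n with hn | hn
    · rw [Nat.succ_sub hn]
      exact h₁ i hi hn
    · rw [h₂ i hn, Nat.sub_eq_zero_of_le hn, pow_zero, pow_one]
  · rw [← h i hi, Nat.succ_sub hn]
  · simpa [Nat.sub_eq_zero_of_le hi] using h i (by omega)

theorem pow_eq_zero_of_mem_steenrodFinite (hp : p ≠ 0) {n : ℕ} {I : Ideal A} {a : ℕ → A}
    (ha : a ∈ steenrodFinite p n I) {i k : ℕ} (hi : 1 ≤ i) (hk : n + 1 - i ≤ k) :
    a i ^ p ^ k = 0 :=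
  pow_eq_zero_of_le (Nat.pow_le_pow_right (Nat.pos_of_ne_zero hp) hk)
    ((mem_steenrodFinite_iff.mp ha).2 i hi)

theorem seqMul_pow_of_mem_steenrodFinite [ExpChar A p] (hp : 2 ≤ p) {I : Ideal A}
    (hI : IsSqZero I) {n : ℕ} {a : ℕ → A} (ha : a ∈ steenrodFinite p n I) (b : ℕ → A) {i : ℕ}
    (hi : 1 ≤ i) : seqMul p a b i ^ p ^ (n + 1 - i) = b i ^ p ^ (n + 1 - i) := by
  rw [seqMul, sum_pow_char_pow, Finset.sum_range_succ, Finset.sum_eq_zero, zero_add,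
    Nat.sub_self, pow_prime_pow_eq_one_of_isSqZero hp hI ha.1 (by omega), one_mul]
  intro j hj
  have hj := Finset.mem_range.mp hj
  rw [mul_pow, ← pow_mul, ← pow_add,
    pow_eq_zero_of_mem_steenrodFinite (by omega) ha (by omega) (by omega), zero_mul]

theorem isSeqSubgroup_steenrodFinite [ExpChar A p] (hp : 2 ≤ p) {I : Ideal A}
    (hI : IsSqZero I) (n : ℕ) : IsSeqSubgroup p (steenrodFinite p n I) := by
  have hp0 : p ≠ 0 := by omega
  have hone : ∀ i : ℕ, 1 ≤ i → (seqOne i : A) ^ p ^ (n + 1 - i) = 0 := fun i hi => by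
    rw [seqOne, if_neg (by omega), zero_pow (pow_ne_zero _ hp0)]
  refine ⟨mem_steenrodFinite_iff.mpr ⟨by simp [seqOne], hone⟩,
    fun a ha b hb => mem_steenrodFinite_iff.mpr ⟨?_, fun i hi => ?_⟩,
    fun a ha b hab _ => mem_steenrodFinite_iff.mpr ⟨?_, fun i hi => ?_⟩⟩
  · rw [seqMul_zero]
    convert I.add_mem (I.mul_mem_right (b 0) ha.1) hb.1 using 1
    ring
  · rw [seqMul_pow_of_mem_steenrodFinite hp hI ha b hi, (mem_steenrodFinite_iff.mp hb).2 i hi]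
  · have h : a 0 * b 0 = 1 := by rw [← seqMul_zero (p := p), hab]; simp [seqOne]
    convert I.neg_mem (I.mul_mem_right (b 0) ha.1) using 1
    linear_combination h
  · rw [← seqMul_pow_of_mem_steenrodFinite hp hI ha b hi, hab, hone i hi]

theorem seqLowerCentral_steenrodFinite_eq [ExpChar A p] (hp : 2 ≤ p) {I : Ideal A}
    (hI : IsSqZero I) {n m : ℕ} (h : ∀ a ∈ seqFiltration I m, ∀ i ≤ n, a i = seqOne i) :
    seqLowerCentral p (steenrodFinite p n I) m = {seqOne} := by
  have hS := isSeqSubgroup_steenrodFinite (p := p) hp hI n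
  refine Set.Subset.antisymm (fun a ha => ?_)
    (Set.singleton_subset_iff.mpr (one_mem_seqLowerCentral hS.1 m))
  refine Set.mem_singleton_iff.mpr (funext fun i => ?_)
  rcases le_or_gt i n with hi | hi
  · exact h a (seqLowerCentral_subset_seqFiltration hp hI (fun _ hx => hx.1) m ha) i hi
  · rw [(seqLowerCentral_subset hS m ha).2.2 i hi, seqOne, if_neg (by omega)]

end SeqMul

/-- Let `p` be a prime, `A` a commutative ring of characteristic `p`
and `I` a square-zero ideal of `A`.  For every `n ≥ 0` the group `G_{p,n}(A,I)` is
nilpotent of class at most `n+1`: `Γ_{n+1}(G_{p,n}(A,I)) = {δ}`.  Moreover, in the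
special case `I = {0}` (so every element has `α_0 = 1`), the group `G_{p,n}(A,{0})` is
nilpotent of class at most `n`: `Γ_n(G_{p,n}(A,{0})) = {δ}`. -/
theorem steenrodFinite_nilpotent {A : Type*} [CommRing A] (p : ℕ) (hp : p.Prime)
    [CharP A p] (I : Ideal A) (hI : IsSqZero I) (n : ℕ) :
    seqLowerCentral p (steenrodFinite p n I) (n + 1) = {seqOne} ∧
    seqLowerCentral p (steenrodFinite p n (⊥ : Ideal A)) n = {seqOne} := by
  have := Fact.mk hp
  have : ExpChar A p := ExpChar.prime hp
  refine ⟨seqLowerCentral_steenrodFinite_eq hp.two_le hI fun a ha i hi =>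
    ha.1 i (Nat.lt_succ_iff.mpr hi), seqLowerCentral_steenrodFinite_eq hp.two_le
    (fun x hx y _ => by rw [Ideal.mem_bot.mp hx, zero_mul]) fun a ha i hi => ?_⟩
  rcases hi.lt_or_eq with h | rfl
  · exact ha.1 i h
  · exact sub_eq_zero.mp (Ideal.mem_bot.mp ha.2)
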